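/- arXiv:2006.08077 — 7 statements merged into one kernel-verified Lean document; each statement's English description precedes it below -/
import Mathlib

section
/- Let X be a Banach space and let g : X → X be a continuous linear operator. Then ‖g‖_α = α(g(B_X)), where B_X denotes the open unit ball of X. -/
/-- The Kuratowski measure of non-compactness of a set `A`: the infimum of all `r > 0`
such that `A` can be covered by finitely many balls of radius at most `r`. -/
noncomputable def alphaMeasure {X : Type*} [SeminormedAddCommGroup X] (A : Set X) : ℝ :=
  sInf {r : ℝ | 0 < r ∧ ∃ S : Finset X, ∃ ρ : X → ℝ,
    (∀ c ∈ S, ρ c ≤ r) ∧ A ⊆ ⋃ c ∈ S, Metric.closedBall c (ρ c)}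

/-- The index of compactness `‖g‖_α` of a map `g : X → X`:
`inf {k > 0 : α(g(A)) ≤ k * α(A) for every bounded A ⊆ X}`. -/
noncomputable def alphaNorm {X : Type*} [SeminormedAddCommGroup X] (g : X → X) : ℝ :=
  sInf {k : ℝ | 0 < k ∧ ∀ A : Set X, Bornology.IsBounded A →
    alphaMeasure (g '' A) ≤ k * alphaMeasure A}

section

open Metric

theorem alphaMeasure_nonneg {X : Type*} [SeminormedAddCommGroup X] (A : Set X) :
    0 ≤ alphaMeasure A :=
  Real.sInf_nonneg fun _ h => h.1.le

theorem alphaMeasure_le_of_subset_iUnion_closedBall {X : Type*} [SeminormedAddCommGroup X]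
    {A : Set X} {r : ℝ} (hr : 0 < r) (S : Finset X) (h : A ⊆ ⋃ c ∈ S, closedBall c r) :
    alphaMeasure A ≤ r :=
  csInf_le ⟨0, fun _ h => h.1.le⟩ ⟨hr, S, fun _ => r, fun _ _ => le_rfl, h⟩

theorem exists_finset_subset_iUnion_closedBall_of_alphaMeasure_lt {X : Type*}
    [SeminormedAddCommGroup X] {A : Set X} (hA : Bornology.IsBounded A) {r : ℝ}
    (hr : alphaMeasure A < r) :
    ∃ S : Finset X, A ⊆ ⋃ c ∈ S, closedBall c r := by
  obtain ⟨R, hR, hAR⟩ := hA.subset_closedBall_lt 0 0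
  obtain ⟨s, ⟨-, S, ρ, hρ, hS⟩, hsr⟩ := exists_lt_of_csInf_lt
    (s := {r : ℝ | 0 < r ∧ ∃ S : Finset X, ∃ ρ : X → ℝ,
      (∀ c ∈ S, ρ c ≤ r) ∧ A ⊆ ⋃ c ∈ S, closedBall c (ρ c)})
    ⟨R, hR, {0}, fun _ => R, fun _ _ => le_rfl, by simpa using hAR⟩ hr
  exact ⟨S, hS.trans (Set.iUnion₂_mono fun c hc =>
    closedBall_subset_closedBall ((hρ c hc).trans hsr.le))⟩

theorem alphaMeasure_image_le_mul {X : Type*} [SeminormedAddCommGroup X] [NormedSpace ℝ X]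
    (g : X →L[ℝ] X) {k : ℝ} (hk : alphaMeasure (g '' ball (0 : X) 1) < k)
    {A : Set X} (hA : Bornology.IsBounded A) :
    alphaMeasure (g '' A) ≤ k * alphaMeasure A := by
  classical
  have hk0 : 0 < k := (alphaMeasure_nonneg _).trans_lt hk
  obtain ⟨T, hT⟩ := exists_finset_subset_iUnion_closedBall_of_alphaMeasure_lt
    (isBounded_ball.image g) hk
  rw [← div_le_iff₀' hk0]
  refine le_of_forall_gt_imp_ge_of_dense fun t ht => ?_
  rw [div_le_iff₀' hk0]
  obtain ⟨r, hAr, hrt⟩ := exists_between ht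
  have ht0 : 0 < t := (alphaMeasure_nonneg A).trans_lt ht
  obtain ⟨S, hS⟩ := exists_finset_subset_iUnion_closedBall_of_alphaMeasure_lt hA hAr
  refine alphaMeasure_le_of_subset_iUnion_closedBall (mul_pos hk0 ht0)
    ((S ×ˢ T).image fun p => g p.1 + t • p.2) ?_
  rintro _ ⟨x, hx, rfl⟩
  obtain ⟨c, hc, hxc⟩ := Set.mem_iUnion₂.1 (hS hx)
  have hu : t⁻¹ • (x - c) ∈ ball (0 : X) 1 := by
    rw [mem_ball_zero_iff, norm_smul, norm_inv, Real.norm_of_nonneg ht0.le,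
      inv_mul_lt_iff₀ ht0, mul_one]
    exact (mem_closedBall_iff_norm.1 hxc).trans_lt hrt
  obtain ⟨d, hd, hud⟩ := Set.mem_iUnion₂.1 (hT (Set.mem_image_of_mem g hu))
  refine Set.mem_iUnion₂.2 ⟨g c + t • d,
    Finset.mem_image.2 ⟨(c, d), Finset.mem_product.2 ⟨hc, hd⟩, rfl⟩, ?_⟩
  have key : g x - (g c + t • d) = t • (g (t⁻¹ • (x - c)) - d) := by
    rw [map_smul, smul_sub, smul_inv_smul₀ ht0.ne', map_sub]
    abel
  rw [mem_closedBall_iff_norm, key, norm_smul, Real.norm_of_nonneg ht0.le, mul_comm k]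
  exact mul_le_mul_of_nonneg_left (mem_closedBall_iff_norm.1 hud) ht0.le

end

/-- For a continuous linear operator `g` on a Banach space `X`,
`‖g‖_α = α(g(B_X))` where `B_X` is the open unit ball of `X`. -/
theorem alphaNorm_eq_alphaMeasure_image_unitBall
    {X : Type*} [NormedAddCommGroup X] [NormedSpace ℝ X] [CompleteSpace X]
    (g : X →L[ℝ] X) :
    alphaNorm (⇑g) = alphaMeasure (⇑g '' Metric.ball (0 : X) 1) := by
  have mem : ∀ k, alphaMeasure (g '' Metric.ball (0 : X) 1) < k →
      k ∈ {k : ℝ | 0 < k ∧ ∀ A : Set X, Bornology.IsBounded A →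
        alphaMeasure (g '' A) ≤ k * alphaMeasure A} := fun k hk =>
    ⟨(alphaMeasure_nonneg _).trans_lt hk, fun _ hA => alphaMeasure_image_le_mul g hk hA⟩
  apply le_antisymm
  · exact le_of_forall_gt_imp_ge_of_dense fun k hk =>
      csInf_le ⟨0, fun _ h => h.1.le⟩ (mem k hk)
  · refine le_csInf ⟨_, mem _ (lt_add_one _)⟩ fun k hk => ?_
    have hball : alphaMeasure (Metric.ball (0 : X) 1) ≤ 1 :=
      alphaMeasure_le_of_subset_iUnion_closedBall one_pos {0}
        (by simpa using Metric.ball_subset_closedBall)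
    exact (hk.2 _ Metric.isBounded_ball).trans (mul_le_of_le_one_right hk.1.le hball)
end

section
/- Let X be a Banach space, f_1, f_2 : X → X commuting C^1 maps (f_1 ∘ f_2 = f_2 ∘ f_1), and K ⊆ X a nonempty compact set with f_1(K) = K and f_2(K) = K. For i ∈ {1,2} let l_α(f_i) := inf_{n≥1} (1/n) log sup_{x∈K} ‖d_x f_i^n‖_α ∈ [−∞, ∞). Then for P_ν-almost every ω ∈ Ω, limsup_{n→∞} (1/n) log sup_{x∈K} ‖d_x f(n, ω)‖_α ≤ ν_1 · l_α(f_1) + ν_2 · l_α(f_2) (an inequality in the extended reals). In particular l_α(f) ≤ ν(f_1) l_α(f_1) + ν(f_2) l_α(f_2). -/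
open MeasureTheory Filter

/-- Extended-real logarithm of a nonnegative real number, with `log 0 = -∞`. -/
noncomputable def elog (x : ℝ) : EReal :=
  if x ≤ 0 then (⊥ : EReal) else ((Real.log x : ℝ) : EReal)

/-- The random composition `f(n, ω) = f_{ω_{n-1}} ∘ ⋯ ∘ f_{ω_1} ∘ f_{ω_0}`, with
`f(0, ω) = id`, for generators `f 0, f 1 : X → X`. -/
def fIter {X : Type*} (f : Fin 2 → X → X) : ℕ → (ℕ → Fin 2) → X → X
  | 0, _, x => x
  | (n + 1), ω, x => f (ω n) (fIter f n ω x)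

/-- `l_α(g) := inf_{n ≥ 1} (1/n) log sup_{x ∈ K} ‖d_x gⁿ‖_α ∈ [-∞, ∞)`,
as an extended real number. -/
noncomputable def lAlpha {X : Type*} [NormedAddCommGroup X] [NormedSpace ℝ X]
    (g : X → X) (K : Set X) : EReal :=
  sInf {y : EReal | ∃ n : ℕ, 1 ≤ n ∧
    y = (((n : ℝ)⁻¹ : ℝ) : EReal) *
      elog (sSup ((fun x => alphaNorm (⇑(fderiv ℝ (g^[n]) x))) '' K))}

lemma alphaMeasure_image_le {X : Type*} [NormedAddCommGroup X] [NormedSpace ℝ X]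
    (T : X →L[ℝ] X) {k : ℝ} (hk : 0 < k) (hT : ‖T‖ ≤ k) {A : Set X}
    (hA : Bornology.IsBounded A) : alphaMeasure (T '' A) ≤ k * alphaMeasure A := by
  classical
  rw [← div_le_iff₀' hk]
  refine le_csInf ?_ ?_
  · obtain ⟨R, hR⟩ := hA.subset_closedBall (0 : X)
    refine ⟨max R 1, by positivity, {0}, fun _ => max R 1, by simp, ?_⟩
    simpa using hR.trans (Metric.closedBall_subset_closedBall (le_max_left _ _))
  · rintro r ⟨hr, S, ρ, hρ, hS⟩
    rw [div_le_iff₀' hk]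
    refine csInf_le ⟨0, fun _ h => h.1.le⟩
      ⟨by positivity, S.image T, fun _ => k * r, fun _ _ => le_rfl, ?_⟩
    rintro _ ⟨x, hx, rfl⟩
    obtain ⟨c, hc, hxc⟩ := Set.mem_iUnion₂.1 (hS hx)
    refine Set.mem_iUnion₂.2 ⟨T c, Finset.mem_image_of_mem _ hc, ?_⟩
    rw [Metric.mem_closedBall, dist_eq_norm, ← map_sub]
    rw [Metric.mem_closedBall, dist_eq_norm] at hxc
    calc ‖T (x - c)‖ ≤ ‖T‖ * ‖x - c‖ := T.le_opNorm _
      _ ≤ k * r := by gcongr; exact hxc.trans (hρ c hc)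

lemma alphaNorm_nonneg {X : Type*} [SeminormedAddCommGroup X] (g : X → X) : 0 ≤ alphaNorm g :=
  Real.sInf_nonneg fun _ h => h.1.le

lemma alphaNorm_le_of_norm_le {X : Type*} [NormedAddCommGroup X] [NormedSpace ℝ X]
    (T : X →L[ℝ] X) {k : ℝ} (hk : 0 < k) (hT : ‖T‖ ≤ k) : alphaNorm T ≤ k :=
  csInf_le ⟨0, fun _ h => h.1.le⟩ ⟨hk, fun _ hA => alphaMeasure_image_le T hk hT hA⟩

lemma alphaNorm_comp_le {X : Type*} [NormedAddCommGroup X] [NormedSpace ℝ X]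
    (S T : X →L[ℝ] X) : alphaNorm (S ∘L T) ≤ alphaNorm S * alphaNorm T := by
  have hne (U : X →L[ℝ] X) : {k : ℝ | 0 < k ∧ ∀ A : Set X, Bornology.IsBounded A →
      alphaMeasure (U '' A) ≤ k * alphaMeasure A}.Nonempty :=
    ⟨‖U‖ + 1, by positivity, fun _ hA => alphaMeasure_image_le U (by positivity) (by simp) hA⟩
  have key : ∀ ε > 0, alphaNorm (S ∘L T) ≤ (alphaNorm S + ε) * (alphaNorm T + ε) := by
    intro ε hε
    obtain ⟨k, ⟨hk, hkS⟩, hkε⟩ := exists_lt_of_csInf_lt (hne S) (lt_add_of_pos_right _ hε)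
    obtain ⟨l, ⟨hl, hlT⟩, hlε⟩ := exists_lt_of_csInf_lt (hne T) (lt_add_of_pos_right _ hε)
    have hkl : alphaNorm (S ∘L T) ≤ k * l := by
      refine csInf_le ⟨0, fun _ h => h.1.le⟩ ⟨by positivity, fun A hA => ?_⟩
      rw [ContinuousLinearMap.coe_comp, Set.image_comp, mul_assoc]
      exact (hkS _ (T.lipschitz.isBounded_image hA)).trans (by gcongr; exact hlT A hA)
    have := alphaNorm_nonneg S
    exact hkl.trans (mul_le_mul hkε.le hlε.le hl.le (by positivity))
  have hlim : Tendsto (fun ε : ℝ => (alphaNorm S + ε) * (alphaNorm T + ε))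
      (nhdsWithin 0 (Set.Ioi 0)) (nhds ((alphaNorm S + 0) * (alphaNorm T + 0))) :=
    (Continuous.tendsto (by fun_prop) 0).mono_left nhdsWithin_le_nhds
  simpa using ge_of_tendsto hlim (eventually_nhdsWithin_of_forall key)

/-- The supremum over `K` of the index of compactness of the derivative of `g`. -/
noncomputable def supAlphaNorm {X : Type*} [NormedAddCommGroup X] [NormedSpace ℝ X]
    (g : X → X) (K : Set X) : ℝ :=
  sSup ((fun x => alphaNorm (⇑(fderiv ℝ g x))) '' K)

section supAlphaNorm

variable {X : Type*} [NormedAddCommGroup X] [NormedSpace ℝ X] {K : Set X} {g h : X → X}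

lemma supAlphaNorm_nonneg (g : X → X) (K : Set X) : 0 ≤ supAlphaNorm g K :=
  Real.sSup_nonneg (by rintro _ ⟨x, -, rfl⟩; exact alphaNorm_nonneg _)

lemma alphaNorm_le_supAlphaNorm (hg : ContDiff ℝ 1 g) (hK : IsCompact K) {x : X} (hx : x ∈ K) :
    alphaNorm (fderiv ℝ g x) ≤ supAlphaNorm g K := by
  refine le_csSup ?_ ⟨x, hx, rfl⟩
  obtain ⟨C, hC⟩ := hK.exists_bound_of_continuousOn
    (hg.continuous_fderiv one_ne_zero).continuousOn
  refine ⟨max C 1, ?_⟩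
  rintro _ ⟨y, hy, rfl⟩
  exact alphaNorm_le_of_norm_le _ (by positivity) ((hC y hy).trans (le_max_left _ _))

lemma supAlphaNorm_comp_le (hg : ContDiff ℝ 1 g) (hh : ContDiff ℝ 1 h) (hK : IsCompact K)
    (hmaps : Set.MapsTo h K K) :
    supAlphaNorm (g ∘ h) K ≤ supAlphaNorm g K * supAlphaNorm h K := by
  refine Real.sSup_le ?_ (mul_nonneg (supAlphaNorm_nonneg _ _) (supAlphaNorm_nonneg _ _))
  rintro _ ⟨x, hx, rfl⟩
  dsimp only
  rw [fderiv_comp x (hg.differentiable one_ne_zero _) (hh.differentiable one_ne_zero _)]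
  exact (alphaNorm_comp_le _ _).trans <| mul_le_mul
    (alphaNorm_le_supAlphaNorm hg hK (hmaps hx)) (alphaNorm_le_supAlphaNorm hh hK hx)
    (alphaNorm_nonneg _) (supAlphaNorm_nonneg _ _)

lemma contDiff_iterate (hg : ContDiff ℝ 1 g) (n : ℕ) : ContDiff ℝ 1 g^[n] := by
  induction n with
  | zero => exact contDiff_id
  | succ n ih => exact ih.comp hg

lemma exists_supAlphaNorm_iterate_le (hg : ContDiff ℝ 1 g) (hK : IsCompact K)
    (hmaps : Set.MapsTo g K K) {c : ℝ} (hc : lAlpha g K < c) :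
    ∃ C > 0, ∀ n : ℕ, supAlphaNorm g^[n] K ≤ C * Real.exp (n * c) := by
  obtain ⟨_, ⟨m, hm, rfl⟩, hlt⟩ := sInf_lt_iff.1 hc
  have hm0 : (0 : ℝ) < m := by exact_mod_cast hm
  have hsm : supAlphaNorm g^[m] K ≤ Real.exp (m * c) := by
    change _ * elog (supAlphaNorm g^[m] K) < _ at hlt
    unfold elog at hlt
    split_ifs at hlt with hs
    · exact hs.trans (Real.exp_pos _).le
    · push Not at hs
      rw [← EReal.coe_mul, EReal.coe_lt_coe_iff, inv_mul_lt_iff₀ hm0] at hlt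
      exact ((Real.log_lt_iff_lt_exp hs).1 hlt).le
  have hterm (r : ℕ) : 0 ≤ supAlphaNorm g^[r] K * Real.exp (-(r * c)) :=
    mul_nonneg (supAlphaNorm_nonneg _ _) (Real.exp_pos _).le
  refine ⟨1 + ∑ r ∈ Finset.range m, supAlphaNorm g^[r] K * Real.exp (-(r * c)),
    add_pos_of_pos_of_nonneg one_pos (Finset.sum_nonneg fun r _ => hterm r), fun n => ?_⟩
  induction n using Nat.strong_induction_on with
  | _ n ih =>
    rcases lt_or_ge n m with hnm | hnm
    · have hle := Finset.single_le_sum (fun r _ => hterm r) (Finset.mem_range.2 hnm)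
      calc supAlphaNorm g^[n] K
          = supAlphaNorm g^[n] K * Real.exp (-(n * c)) * Real.exp (n * c) := by
            rw [mul_assoc, ← Real.exp_add]; simp
        _ ≤ _ := by gcongr; linarith
    · obtain ⟨k, rfl⟩ := Nat.exists_eq_add_of_le hnm
      rw [Function.iterate_add]
      calc supAlphaNorm (g^[m] ∘ g^[k]) K
          ≤ supAlphaNorm g^[m] K * supAlphaNorm g^[k] K :=
            supAlphaNorm_comp_le (contDiff_iterate hg m) (contDiff_iterate hg k) hK
              (hmaps.iterate k)
        _ ≤ Real.exp (m * c) * _ :=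
            mul_le_mul hsm (ih k (by omega)) (supAlphaNorm_nonneg _ _) (Real.exp_pos _).le
        _ = _ := by push_cast; rw [add_mul (m : ℝ), Real.exp_add]; ring

end supAlphaNorm

lemma fIter_eq_iterate_comp {X : Type*} {f : Fin 2 → X → X} (hcomm : f 0 ∘ f 1 = f 1 ∘ f 0)
    (ω : ℕ → Fin 2) (n : ℕ) :
    fIter f n ω = (f 0)^[Nat.count (fun i => ω i = 0) n] ∘
      (f 1)^[Nat.count (fun i => ω i = 1) n] := by
  have hc : Function.Commute (f 0) (f 1) := congrFun hcomm
  induction n with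
  | zero => rfl
  | succ n ih =>
    funext x
    have hstep : fIter f (n + 1) ω x = f (ω n) (fIter f n ω x) := rfl
    rw [hstep, ih, Nat.count_succ, Nat.count_succ]
    obtain h | h : ω n = 0 ∨ ω n = 1 := by have := (ω n).isLt; omega
    · simp [h, -Function.iterate_succ, Function.iterate_succ_apply']
    · simpa [h, -Function.iterate_succ, Function.iterate_succ_apply'] using
        (hc.symm.iterate_right _) _

lemma elog_le_of_le_exp {x y : ℝ} (h : x ≤ Real.exp y) : elog x ≤ y := by
  unfold elog
  split_ifs with hx
  · exact bot_le
  · push Not at hx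
    exact_mod_cast (Real.log_le_iff_le_exp hx).2 h

lemma bernoulli_eq_infinitePi {ν : Fin 2 → ℝ} {P : Measure (ℕ → Fin 2)} [IsProbabilityMeasure P]
    (hν : ∀ i, 0 ≤ ν i)
    (hP : ∀ (n : ℕ) (a : Fin n → Fin 2),
      P {ω | ∀ m : Fin n, ω m = a m} = ENNReal.ofReal (∏ m : Fin n, ν (a m))) :
    P = Measure.infinitePi fun _ : ℕ => P.map (Function.eval 0) := by
  have : IsProbabilityMeasure (P.map (Function.eval 0)) :=
    Measure.isProbabilityMeasure_map (measurable_pi_apply 0).aemeasurable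
  have hμ (j : Fin 2) : P.map (Function.eval 0) {j} = ENNReal.ofReal (ν j) := by
    rw [Measure.map_apply (measurable_pi_apply 0) (measurableSet_singleton j)]
    simpa [Set.preimage] using hP 1 fun _ => j
  refine Measure.eq_infinitePi _ fun s t ht => ?_
  classical
  obtain ⟨n, hn⟩ := s.exists_nat_subset_range
  have hr : Measurable fun (ω : ℕ → Fin 2) (m : Fin n) => ω m := by fun_prop
  have hmap : P.map (fun ω (m : Fin n) => ω m) =
      Measure.pi fun _ : Fin n => P.map (Function.eval 0) := by
    refine Measure.ext_of_singleton fun a => ?_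
    rw [Measure.map_apply hr (measurableSet_singleton a), Measure.pi_singleton]
    simp_rw [hμ]
    rw [← ENNReal.ofReal_prod_of_nonneg fun i _ => hν _, ← hP n a]
    congr 1
    ext ω
    simp [funext_iff]
  have hset : Set.pi (s : Set ℕ) t = (fun (ω : ℕ → Fin 2) (m : Fin n) => ω m) ⁻¹'
      Set.univ.pi fun m : Fin n => if (m : ℕ) ∈ s then t m else Set.univ := by
    ext ω
    simp only [Set.mem_pi, Set.mem_preimage, Set.mem_univ, forall_true_left, Finset.mem_coe]
    refine ⟨fun h m => ?_, fun h i hi => ?_⟩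
    · split_ifs with hm
      · exact h m hm
      · trivial
    · simpa [hi] using h ⟨i, Finset.mem_range.1 (hn hi)⟩
  rw [hset, ← Measure.map_apply hr (.univ_pi fun m => by split_ifs <;> simp), hmap,
    Measure.pi_pi,
    Fin.prod_univ_eq_prod_range
      (fun m => P.map (Function.eval 0) (if m ∈ s then t m else Set.univ)) n,
    ← Finset.prod_subset hn fun i _ hi => by simp [hi]]
  exact Finset.prod_congr rfl fun i hi => by simp [hi]

lemma ae_tendsto_count_div {ν : Fin 2 → ℝ} {P : Measure (ℕ → Fin 2)} [IsProbabilityMeasure P]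
    (hν : ∀ i, 0 ≤ ν i)
    (hP : ∀ (n : ℕ) (a : Fin n → Fin 2),
      P {ω | ∀ m : Fin n, ω m = a m} = ENNReal.ofReal (∏ m : Fin n, ν (a m))) (j : Fin 2) :
    ∀ᵐ ω ∂P, Tendsto (fun n : ℕ => (Nat.count (fun i => ω i = j) n : ℝ) / n) atTop
      (nhds (ν j)) := by
  have hprod := bernoulli_eq_infinitePi hν hP
  have : IsProbabilityMeasure (P.map (Function.eval 0)) :=
    Measure.isProbabilityMeasure_map (measurable_pi_apply 0).aemeasurable
  set g : Fin 2 → ℝ := fun k => if k = j then 1 else 0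
  have hg : Measurable g := measurable_of_finite g
  have hgm (i : ℕ) : Measurable fun ω : ℕ → Fin 2 => g (ω i) := hg.comp (measurable_pi_apply i)
  have hind : ProbabilityTheory.iIndepFun (fun (i : ℕ) ω => g (ω i)) P := by
    rw [hprod]
    exact ProbabilityTheory.iIndepFun_infinitePi (X := fun _ => g) fun _ => hg
  have hmarg (i : ℕ) : P.map (fun ω => ω i) = P.map (Function.eval 0) := by
    conv_lhs => rw [hprod]
    exact Measure.infinitePi_map_eval _ i
  have hident (i : ℕ) : ProbabilityTheory.IdentDistrib (fun ω => g (ω i)) (fun ω => g (ω 0)) P P :=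
    ProbabilityTheory.IdentDistrib.comp (u := g)
      ⟨(measurable_pi_apply i).aemeasurable, (measurable_pi_apply 0).aemeasurable, hmarg i⟩ hg
  have hint : Integrable (fun ω : ℕ → Fin 2 => g (ω 0)) P := by
    refine Integrable.of_bound (hgm 0).aestronglyMeasurable 1 (ae_of_all _ fun ω => ?_)
    simp only [g]
    split_ifs <;> simp
  have hmean : ∫ ω, g (ω 0) ∂P = ν j := by
    have hset : MeasurableSet {ω : ℕ → Fin 2 | ω 0 = j} :=
      measurableSet_eq_fun (measurable_pi_apply 0) measurable_const
    have hfun : (fun ω : ℕ → Fin 2 => g (ω 0)) = Set.indicator {ω | ω 0 = j} 1 := by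
      ext ω
      simp [g, Set.indicator_apply]
    have h1 : P {ω | ω 0 = j} = ENNReal.ofReal (ν j) := by simpa using hP 1 fun _ => j
    rw [hfun, integral_indicator_one hset, measureReal_def, h1, ENNReal.toReal_ofReal (hν j)]
  filter_upwards [ProbabilityTheory.strong_law_ae_real (fun i ω => g (ω i)) hint
    (fun i k hik => hind.indepFun hik) hident] with ω hω
  rw [hmean] at hω
  simpa [g, Nat.count_eq_card_filter_range, Finset.sum_boole] using hω

lemma EReal.exists_real_gt_mul_le {a : ℝ} (ha : 0 < a) {L y : EReal} (h : a * L < y) :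
    ∃ c : ℝ, L < c ∧ ((a * c : ℝ) : EReal) ≤ y := by
  obtain ⟨z, hz, hzy⟩ := EReal.lt_iff_exists_real_btwn.1 h
  have haz : a * (z / a) = z := by field_simp
  refine ⟨z / a, ?_, by rw [haz]; exact hzy.le⟩
  by_contra! hle
  refine absurd hz (not_lt.2 ?_)
  calc (z : EReal) = a * ((z / a : ℝ) : EReal) := by rw [← EReal.coe_mul, haz]
    _ ≤ a * L := by gcongr

lemma lAlpha_ne_top {X : Type*} [NormedAddCommGroup X] [NormedSpace ℝ X] (g : X → X)
    (K : Set X) : lAlpha g K ≠ ⊤ := by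
  refine ne_top_of_le_ne_top ?_ (sInf_le ⟨1, le_rfl, rfl⟩)
  unfold elog
  split_ifs <;> simp

lemma EReal.coe_mul_ne_top {a : ℝ} (ha : 0 < a) {L : EReal} (hL : L ≠ ⊤) : (a : EReal) * L ≠ ⊤ := by
  induction L with
  | bot => simp [EReal.coe_mul_bot_of_pos ha]
  | coe x => rw [← EReal.coe_mul]; exact EReal.coe_ne_top _
  | top => exact absurd rfl hL

/-- Let `f_1, f_2` be commuting `C¹` maps of a Banach space `X` and `K` a nonempty
compact set invariant under both.  Let `P` be the Bernoulli measure on `Ω = {1,2}^ℕ`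
with weights `ν 0, ν 1 > 0`, `ν 0 + ν 1 = 1`.  Then for `P`-a.e. `ω`,
`limsup (1/n) log sup_{x ∈ K} ‖d_x f(n, ω)‖_α ≤ ν 0 * l_α(f_1) + ν 1 * l_α(f_2)`
in the extended reals; in particular `l_α(f) ≤ ν(f_1) l_α(f_1) + ν(f_2) l_α(f_2)`. -/
theorem lAlpha_random_le_weighted_sum
    {X : Type*} [NormedAddCommGroup X] [NormedSpace ℝ X] [CompleteSpace X]
    (f : Fin 2 → X → X) (hf : ∀ i, ContDiff ℝ 1 (f i))
    (hcomm : f 0 ∘ f 1 = f 1 ∘ f 0)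
    (K : Set X) (hK : IsCompact K) (hKne : K.Nonempty) (hinv : ∀ i, f i '' K = K)
    (ν : Fin 2 → ℝ) (hν : ∀ i, 0 < ν i) (hνsum : ν 0 + ν 1 = 1)
    (P : Measure (ℕ → Fin 2)) [IsProbabilityMeasure P]
    (hP : ∀ (n : ℕ) (a : Fin n → Fin 2),
      P {ω | ∀ m : Fin n, ω m = a m} = ENNReal.ofReal (∏ m : Fin n, ν (a m))) :
    ∀ᵐ ω ∂P,
      Filter.limsup
        (fun n : ℕ => (((n : ℝ)⁻¹ : ℝ) : EReal) *
          elog (sSup ((fun x => alphaNorm (⇑(fderiv ℝ (fIter f n ω) x))) '' K)))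
        Filter.atTop
      ≤ ((ν 0 : ℝ) : EReal) * lAlpha (f 0) K + ((ν 1 : ℝ) : EReal) * lAlpha (f 1) K := by
  have hmaps (i : Fin 2) : Set.MapsTo (f i) K K := fun x hx => hinv i ▸ Set.mem_image_of_mem _ hx
  have hbound (ω : ℕ → Fin 2) (n : ℕ) : supAlphaNorm (fIter f n ω) K ≤
      supAlphaNorm (f 0)^[Nat.count (fun i => ω i = 0) n] K *
        supAlphaNorm (f 1)^[Nat.count (fun i => ω i = 1) n] K := by
    rw [fIter_eq_iterate_comp hcomm]
    exact supAlphaNorm_comp_le (contDiff_iterate (hf 0) _) (contDiff_iterate (hf 1) _) hK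
      ((hmaps 1).iterate _)
  filter_upwards [ae_tendsto_count_div (fun i => (hν i).le) hP 0,
    ae_tendsto_count_div (fun i => (hν i).le) hP 1] with ω h0 h1
  have key (c d : ℝ) (hc : lAlpha (f 0) K < c) (hd : lAlpha (f 1) K < d) :
      limsup (fun n : ℕ => (((n : ℝ)⁻¹ : ℝ) : EReal) * elog (supAlphaNorm (fIter f n ω) K)) atTop
        ≤ ((ν 0 * c + ν 1 * d : ℝ) : EReal) := by
    obtain ⟨C, hC, hCle⟩ := exists_supAlphaNorm_iterate_le (hf 0) hK (hmaps 0) hc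
    obtain ⟨D, hD, hDle⟩ := exists_supAlphaNorm_iterate_le (hf 1) hK (hmaps 1) hd
    set a : ℕ → ℕ := fun n => Nat.count (fun i => ω i = 0) n
    set b : ℕ → ℕ := fun n => Nat.count (fun i => ω i = 1) n
    have hle (n : ℕ) : (((n : ℝ)⁻¹ : ℝ) : EReal) * elog (supAlphaNorm (fIter f n ω) K) ≤
        ((Real.log (C * D) / n + a n / n * c + b n / n * d : ℝ) : EReal) := by
      have hexp : supAlphaNorm (fIter f n ω) K ≤
          Real.exp (Real.log (C * D) + a n * c + b n * d) := by
        refine (hbound ω n).trans ((mul_le_mul (hCle (a n)) (hDle (b n))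
          (supAlphaNorm_nonneg _ _) (by positivity)).trans_eq ?_)
        rw [Real.exp_add, Real.exp_add, Real.exp_log (by positivity)]
        ring
      calc _ ≤ (((n : ℝ)⁻¹ : ℝ) : EReal) *
            ((Real.log (C * D) + a n * c + b n * d : ℝ) : EReal) := by
            gcongr
            exact elog_le_of_le_exp hexp
        _ = _ := by rw [← EReal.coe_mul]; congr 1; ring
    have hlim : Tendsto (fun n : ℕ => Real.log (C * D) / n + a n / n * c + b n / n * d) atTop
        (nhds (0 + ν 0 * c + ν 1 * d)) :=
      ((tendsto_const_div_atTop_nhds_zero_nat _).add (h0.mul_const c)).add (h1.mul_const d)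
    rw [zero_add] at hlim
    exact (limsup_le_limsup (Eventually.of_forall hle)).trans_eq
      ((continuous_coe_real_ereal.tendsto _).comp hlim).limsup_eq
  refine EReal.le_add_of_forall_gt (.inr (EReal.coe_mul_ne_top (hν 1) (lAlpha_ne_top _ _)))
    (.inl (EReal.coe_mul_ne_top (hν 0) (lAlpha_ne_top _ _))) fun y hy z hz => ?_
  obtain ⟨c, hc, hcy⟩ := EReal.exists_real_gt_mul_le (hν 0) hy
  obtain ⟨d, hd, hdz⟩ := EReal.exists_real_gt_mul_le (hν 1) hz
  refine (key c d hc hd).trans ?_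
  rw [EReal.coe_add]
  exact add_le_add hcy hdz
end

section
/- Let X be a Banach space and f_1, f_2 : X → X commuting C^1 maps (f_1 ∘ f_2 = f_2 ∘ f_1). Fix x ∈ X, a vector v ∈ X with v ≠ 0, and real numbers λ_1, λ_2. Suppose that for every ε > 0 there exists Q = Q(ε) ≥ 1 such that for all t_1, t_2 ∈ ℕ, Q^{−1}‖v‖ exp(t_1λ_1 + t_2λ_2 − 3(t_1+t_2)ε) ≤ ‖d_x (f_1^{t_1} ∘ f_2^{t_2}) v‖ ≤ Q‖v‖ exp(t_1λ_1 + t_2λ_2 + 3(t_1+t_2)ε). Then for P_ν-almost every ω ∈ Ω, lim_{n→∞} (1/n) log ‖d_x f(n, ω) v‖ = ν_1 λ_1 + ν_2 λ_2. -/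
open MeasureTheory Filter

/-- A measure on sequences with the cylinder probabilities of an i.i.d. sequence is the infinite
product measure. -/
theorem eq_infinitePi_of_cylinder {α : Type*} [Countable α] [MeasurableSpace α]
    [MeasurableSingletonClass α] (μ : Measure α) [IsProbabilityMeasure μ]
    (P : Measure (ℕ → α))
    (hP : ∀ (n : ℕ) (a : Fin n → α), P {ω | ∀ m : Fin n, ω m = a m} = ∏ m, μ {a m}) :
    P = Measure.infinitePi (fun _ : ℕ => μ) := by
  refine Measure.eq_infinitePi _ fun s t ht => ?_
  obtain ⟨n, hn⟩ := s.exists_nat_subset_range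
  have hmeas : Measurable (fun (ω : ℕ → α) (m : Fin n) => ω m) := by fun_prop
  have hmap : P.map (fun (ω : ℕ → α) (m : Fin n) => ω m) = Measure.pi (fun _ => μ) := by
    refine Measure.ext_of_singleton fun a => ?_
    rw [Measure.map_apply hmeas (measurableSet_singleton a), Measure.pi_singleton, ← hP n a]
    congr 1
    ext ω
    simp [funext_iff]
  classical
  let t' : ℕ → Set α := fun i => if i ∈ s then t i else Set.univ
  have ht' : ∀ i, MeasurableSet (t' i) := fun i => by
    by_cases hi : i ∈ s
    · simpa [t', hi] using ht i
    · simp [t', hi]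
  have hpre : Set.pi s t =
      (fun (ω : ℕ → α) (m : Fin n) => ω m) ⁻¹' Set.pi Set.univ (fun m : Fin n => t' m) := by
    ext ω
    simp only [Set.mem_pi, Set.mem_preimage, Set.mem_univ, true_imp_iff, Finset.mem_coe]
    constructor
    · intro h m
      by_cases hm : (m : ℕ) ∈ s
      · simpa [t', hm] using h m hm
      · simp [t', hm]
    · intro h i hi
      simpa [t', hi] using h ⟨i, Finset.mem_range.1 (hn hi)⟩
  rw [hpre, ← Measure.map_apply hmeas (MeasurableSet.univ_pi fun m => ht' m), hmap,
    Measure.pi_pi, Fin.prod_univ_eq_prod_range (fun i => μ (t' i)) n]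
  rw [← Finset.prod_subset hn fun i _ hi => by simp [t', hi]]
  exact Finset.prod_congr rfl fun i hi => by simp [t', hi]

/-- For an i.i.d. sequence, the frequency of a symbol converges almost surely to its
probability. -/
theorem ae_tendsto_count_div_s8 {α : Type*} [DecidableEq α] [MeasurableSpace α]
    [MeasurableSingletonClass α] (μ : Measure α) [IsProbabilityMeasure μ] (a : α) :
    ∀ᵐ ω ∂Measure.infinitePi (fun _ : ℕ => μ),
      Tendsto (fun n : ℕ => (Nat.count (fun i => ω i = a) n : ℝ) / n) atTop
        (nhds (μ.real {a})) := by
  set φ : α → ℝ := Set.indicator {a} 1 with hφ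
  have hφm : Measurable φ := measurable_one.indicator (measurableSet_singleton a)
  have hmp : ∀ i : ℕ, MeasurePreserving (fun ω : ℕ → α => ω i)
      (Measure.infinitePi fun _ : ℕ => μ) μ := fun i =>
    ⟨by fun_prop, Measure.infinitePi_map_eval _ i⟩
  have hφi : Integrable φ μ := (integrable_const 1).indicator (measurableSet_singleton a)
  have hlaw := ProbabilityTheory.strong_law_ae_real
    (μ := Measure.infinitePi fun _ : ℕ => μ) (fun i ω => φ (ω i))
    ((hmp 0).integrable_comp_of_integrable hφi)
    (fun i j hij => (ProbabilityTheory.iIndepFun_infinitePi (P := fun _ : ℕ => μ)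
      (X := fun _ => φ) fun _ => hφm).indepFun hij)
    (fun i => ⟨(hφm.comp (hmp i).measurable).aemeasurable,
      (hφm.comp (hmp 0).measurable).aemeasurable, by
      change Measure.map (φ ∘ fun ω : ℕ → α => ω i) _ = Measure.map (φ ∘ fun ω : ℕ → α => ω 0) _
      rw [← Measure.map_map hφm (hmp i).measurable, ← Measure.map_map hφm (hmp 0).measurable,
        (hmp i).map_eq, (hmp 0).map_eq]⟩)
  have hint : ∫ ω, φ (ω 0) ∂(Measure.infinitePi fun _ : ℕ => μ) = μ.real {a} := by
    rw [← integral_map (φ := fun ω : ℕ → α => ω 0) (hmp 0).measurable.aemeasurable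
        hφm.aestronglyMeasurable,
      (hmp 0).map_eq, hφ, integral_indicator_one (measurableSet_singleton a)]
  rw [hint] at hlaw
  filter_upwards [hlaw] with ω hω
  refine hω.congr fun n => ?_
  simp only [hφ, Nat.count_eq_card_filter_range, Set.indicator_apply, Set.mem_singleton_iff,
    Pi.one_apply, Finset.sum_boole]

theorem fIter_eq_iterate {X : Type*} (f : Fin 2 → X → X) (hcomm : f 0 ∘ f 1 = f 1 ∘ f 0)
    (ω : ℕ → Fin 2) (n : ℕ) :
    fIter f n ω =
      (f 0)^[Nat.count (fun i => ω i = 0) n] ∘ (f 1)^[Nat.count (fun i => ω i = 1) n] := by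
  have hc : Function.Commute (f 1) (f 0) := fun y => (congrFun hcomm y).symm
  induction n with
  | zero => rfl
  | succ n ih =>
    funext y
    have hi : ω n = 0 ∨ ω n = 1 := by generalize ω n = i; fin_cases i <;> simp
    simp only [fIter, ih, Nat.count_succ]
    rcases hi with h | h
    · simp [h, Function.iterate_succ_apply', -Function.iterate_succ]
    · simp [h, Function.iterate_succ_apply', -Function.iterate_succ, (hc.iterate_right _).eq]

theorem count_zero_add_count_one (ω : ℕ → Fin 2) (n : ℕ) :
    Nat.count (fun i => ω i = 0) n + Nat.count (fun i => ω i = 1) n = n := by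
  induction n with
  | zero => rfl
  | succ n ih =>
    have hi : ω n = 0 ∨ ω n = 1 := by generalize ω n = i; fin_cases i <;> simp
    rcases hi with h | h <;> simp [Nat.count_succ, h] <;> omega

theorem abs_log_sub_le_of_exp_bounds {Q r N s δ : ℝ} (hQ : 1 ≤ Q) (hr : 0 < r)
    (hl : Q⁻¹ * r * Real.exp (s - δ) ≤ N) (hu : N ≤ Q * r * Real.exp (s + δ)) :
    |Real.log N - s| ≤ Real.log Q + |Real.log r| + δ := by
  have hQ0 : 0 < Q := by linarith
  have hlow : 0 < Q⁻¹ * r * Real.exp (s - δ) := by positivity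
  have h1 := Real.log_le_log hlow hl
  have h2 := Real.log_le_log (hlow.trans_le hl) hu
  rw [Real.log_mul (by positivity) (by positivity), Real.log_mul (by positivity) (by positivity),
    Real.log_exp] at h1 h2
  rw [Real.log_inv] at h1
  have h3 := neg_abs_le (Real.log r)
  have h4 := le_abs_self (Real.log r)
  rw [abs_le]
  constructor <;> linarith

/-- A sequence within `o(n)` of `s` has the same Cesàro-type limit as `s`. -/
theorem tendsto_inv_mul_of_forall_abs_sub_le {u s : ℕ → ℝ} {l : ℝ}
    (hs : Tendsto (fun n : ℕ => (n : ℝ)⁻¹ * s n) atTop (nhds l))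
    (hu : ∀ ε : ℝ, 0 < ε → ∃ C : ℝ, ∀ n : ℕ, |u n - s n| ≤ C + n * ε) :
    Tendsto (fun n : ℕ => (n : ℝ)⁻¹ * u n) atTop (nhds l) := by
  have hd : Tendsto (fun n : ℕ => (n : ℝ)⁻¹ * (u n - s n)) atTop (nhds 0) := by
    rw [Metric.tendsto_atTop']
    intro ε hε
    obtain ⟨C, hC⟩ := hu (ε / 2) (half_pos hε)
    have hev : ∀ᶠ n : ℕ in atTop, C / n < ε / 2 :=
      (tendsto_const_div_atTop_nhds_zero_nat C).eventually_lt_const (half_pos hε)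
    obtain ⟨K, hK⟩ := eventually_atTop.1 hev
    refine ⟨K, fun n hn => ?_⟩
    have hn0 : (0 : ℝ) < n := by exact_mod_cast (Nat.zero_le K).trans_lt hn
    have hKn := hK n hn.le
    rw [Real.dist_0_eq_abs, abs_mul, abs_inv, Nat.abs_cast]
    calc (n : ℝ)⁻¹ * |u n - s n| ≤ (n : ℝ)⁻¹ * (C + n * (ε / 2)) := by gcongr; exact hC n
      _ = C / n + ε / 2 := by field_simp
      _ < ε := by linarith
  have h := hd.add hs
  rw [zero_add] at h
  exact h.congr fun n => by ring

/-- Let `f_1, f_2` be commuting `C¹` maps of a Banach space `X`, `x ∈ X`, `v ≠ 0`, and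
`λ_1, λ_2 ∈ ℝ`.  Suppose for every `ε > 0` there is `Q ≥ 1` with
`Q⁻¹‖v‖ exp(t₁λ₁ + t₂λ₂ - 3(t₁+t₂)ε) ≤ ‖d_x (f_1^{t₁} ∘ f_2^{t₂}) v‖ ≤`
`Q‖v‖ exp(t₁λ₁ + t₂λ₂ + 3(t₁+t₂)ε)` for all `t₁, t₂ ∈ ℕ`.  Then for `P_ν`-a.e. `ω`,
`lim_{n→∞} (1/n) log ‖d_x f(n, ω) v‖ = ν₁ λ₁ + ν₂ λ₂`. -/
theorem random_lyapunov_exponent_eq_weighted_sum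
    {X : Type*} [NormedAddCommGroup X] [NormedSpace ℝ X] [CompleteSpace X]
    (f : Fin 2 → X → X) (hf : ∀ i, ContDiff ℝ 1 (f i))
    (hcomm : f 0 ∘ f 1 = f 1 ∘ f 0)
    (x v : X) (hv : v ≠ 0) (lam₁ lam₂ : ℝ)
    (hQ : ∀ ε : ℝ, 0 < ε → ∃ Q : ℝ, 1 ≤ Q ∧ ∀ t₁ t₂ : ℕ,
      Q⁻¹ * ‖v‖ * Real.exp (t₁ * lam₁ + t₂ * lam₂ - 3 * (t₁ + t₂) * ε) ≤
        ‖fderiv ℝ ((f 0)^[t₁] ∘ (f 1)^[t₂]) x v‖ ∧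
      ‖fderiv ℝ ((f 0)^[t₁] ∘ (f 1)^[t₂]) x v‖ ≤
        Q * ‖v‖ * Real.exp (t₁ * lam₁ + t₂ * lam₂ + 3 * (t₁ + t₂) * ε))
    (ν : Fin 2 → ℝ) (hν : ∀ i, 0 < ν i) (hνsum : ν 0 + ν 1 = 1)
    (P : Measure (ℕ → Fin 2)) [IsProbabilityMeasure P]
    (hP : ∀ (n : ℕ) (a : Fin n → Fin 2),
      P {ω | ∀ m : Fin n, ω m = a m} = ENNReal.ofReal (∏ m : Fin n, ν (a m))) :
    ∀ᵐ ω ∂P,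
      Filter.Tendsto
        (fun n : ℕ => (n : ℝ)⁻¹ * Real.log ‖fderiv ℝ (fIter f n ω) x v‖)
        Filter.atTop (nhds (ν 0 * lam₁ + ν 1 * lam₂)) := by
  let μ : Measure (Fin 2) := Measure.sum fun i => ENNReal.ofReal (ν i) • Measure.dirac i
  have hμ : ∀ i, μ {i} = ENNReal.ofReal (ν i) := fun i => by
    fin_cases i <;> simp [μ]
  have : IsProbabilityMeasure μ := ⟨by
    simp [μ, ← ENNReal.ofReal_add (hν 0).le (hν 1).le, hνsum]⟩
  have hPμ : P = Measure.infinitePi (fun _ : ℕ => μ) :=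
    eq_infinitePi_of_cylinder μ P fun n a => by
      rw [hP, ENNReal.ofReal_prod_of_nonneg fun m _ => (hν (a m)).le]
      exact Finset.prod_congr rfl fun m _ => (hμ (a m)).symm
  have hfreq : ∀ j, ∀ᵐ ω ∂P,
      Tendsto (fun n : ℕ => (Nat.count (fun i => ω i = j) n : ℝ) / n) atTop (nhds (ν j)) := by
    intro j
    have h := ae_tendsto_count_div_s8 μ j
    rwa [← hPμ, measureReal_def, hμ, ENNReal.toReal_ofReal (hν j).le] at h
  filter_upwards [hfreq 0, hfreq 1] with ω h0 h1
  refine tendsto_inv_mul_of_forall_abs_sub_le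
    (s := fun n => Nat.count (fun i => ω i = 0) n * lam₁ + Nat.count (fun i => ω i = 1) n * lam₂)
    (Tendsto.congr (fun n => ?_) ((h0.mul_const lam₁).add (h1.mul_const lam₂))) fun ε hε => ?_
  · ring
  obtain ⟨Q, hQ1, hb⟩ := hQ (ε / 3) (by positivity)
  refine ⟨Real.log Q + |Real.log ‖v‖|, fun n => ?_⟩
  obtain ⟨hl, hu⟩ := hb (Nat.count (fun i => ω i = 0) n) (Nat.count (fun i => ω i = 1) n)
  have hδ : 3 * ((Nat.count (fun i => ω i = 0) n : ℝ) + Nat.count (fun i => ω i = 1) n) * (ε / 3)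
      = n * ε := by
    rw [← Nat.cast_add, count_zero_add_count_one]
    ring
  rw [hδ] at hl hu
  rw [fIter_eq_iterate f hcomm]
  exact abs_log_sub_le_of_exp_bounds hQ1 (norm_pos_iff.2 hv) hl hu
end

section
/- Let X be a Banach space and f_1, f_2 : X → X commuting C^1 maps (f_1 ∘ f_2 = f_2 ∘ f_1). Fix x ∈ X, a vector v ∈ X with v ≠ 0, and real numbers λ_α, λ_2. Suppose that for every ε > 0 there exists Q = Q(ε) ≥ 1 such that for all t_1, t_2 ∈ ℕ, ‖d_x (f_1^{t_1} ∘ f_2^{t_2}) v‖ ≤ Q‖v‖ exp(t_1λ_α + t_2λ_2 + 3(t_1+t_2)ε). Then for P_ν-almost every ω ∈ Ω, limsup_{n→∞} (1/n) log ‖d_x f(n, ω) v‖ ≤ ν_1 λ_α + ν_2 λ_2. -/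
open MeasureTheory Filter

open scoped Topology

/-- A measure on sequences in a countable space is the product of copies of `μ` as soon as it gives
every initial cylinder the product mass. -/
theorem eq_infinitePi_of_forall_initial_cylinder {α : Type*} [Countable α] [MeasurableSpace α]
    [MeasurableSingletonClass α] (μ : Measure α) [IsProbabilityMeasure μ] (P : Measure (ℕ → α))
    (h : ∀ (n : ℕ) (a : Fin n → α), P {ω | ∀ m : Fin n, ω m = a m} = ∏ m, μ {a m}) :
    P = Measure.infinitePi fun _ : ℕ => μ := by
  have hlim : IsProjectiveLimit P fun I : Finset ℕ => Measure.pi fun _ : I => μ := by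
    refine (isProjectiveLimit_nat_iff (isProjectiveMeasureFamily_pi fun _ : ℕ => μ) P).2
      fun n => Measure.ext_of_singleton fun a => ?_
    let b : ℕ → α := fun m => if hm : m ∈ Finset.Iic n then a ⟨m, hm⟩ else a ⟨n, by simp⟩
    have hb : ∀ m : Finset.Iic n, b m = a m := fun m => dif_pos m.2
    rw [Measure.map_apply (Preorder.measurable_frestrictLe n) (measurableSet_singleton a),
      Measure.pi_singleton]
    have hpre : (Preorder.frestrictLe n : (ℕ → α) → Finset.Iic n → α) ⁻¹' {a} =
        {ω : ℕ → α | ∀ m : Fin (n + 1), ω m = b m} := by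
      ext ω
      simp only [Set.mem_preimage, Set.mem_singleton_iff, Set.mem_ofPred_eq, funext_iff]
      constructor
      · intro hω m
        have hm : (m : ℕ) ∈ Finset.Iic n := Finset.mem_Iic.2 (Nat.lt_succ_iff.1 m.2)
        exact (hω ⟨m, hm⟩).trans (hb ⟨m, hm⟩).symm
      · intro hω m
        exact (hω ⟨m, Nat.lt_succ_iff.2 (Finset.mem_Iic.1 m.2)⟩).trans (hb m)
    rw [hpre, h (n + 1) fun m => b m, Fin.prod_univ_eq_prod_range (fun m => μ {b m}) (n + 1),
      Nat.range_succ_eq_Iic, ← Finset.prod_coe_sort]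
    exact Finset.prod_congr rfl fun m _ => by rw [hb m]
  exact hlim.unique (Measure.isProjectiveLimit_infinitePi fun _ : ℕ => μ)

/-- Asymptotic frequency of a symbol under a product measure. -/
theorem ae_tendsto_card_filter_div_infinitePi {α : Type*} [DecidableEq α] [MeasurableSpace α]
    [MeasurableSingletonClass α] (μ : Measure α) [IsProbabilityMeasure μ] (j : α) :
    ∀ᵐ ω ∂(Measure.infinitePi fun _ : ℕ => μ),
      Tendsto (fun n : ℕ => (((Finset.range n).filter fun m => ω m = j).card : ℝ) / n) atTop
        (𝓝 (μ.real {j})) := by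
  let g : α → ℝ := Set.indicator {j} fun _ => 1
  have hg : Measurable g := measurable_const.indicator (measurableSet_singleton j)
  have hmap : ∀ i : ℕ,
      Measure.map (fun ω : ℕ → α => g (ω i)) (Measure.infinitePi fun _ : ℕ => μ) = μ.map g := by
    intro i
    have heval := Measure.infinitePi_map_eval (fun _ : ℕ => μ) i
    conv_rhs => rw [← heval, Measure.map_map hg (measurable_pi_apply i)]
    rfl
  have hindep := ProbabilityTheory.iIndepFun_infinitePi (P := fun _ : ℕ => μ)
    (X := fun _ => g) fun _ => hg
  have hmeas : ∀ i : ℕ, Measurable fun ω : ℕ → α => g (ω i) := fun i =>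
    hg.comp (measurable_pi_apply i)
  have hslln := ProbabilityTheory.strong_law_ae_real (μ := Measure.infinitePi fun _ : ℕ => μ)
    (fun (i : ℕ) ω => g (ω i))
    ((integrable_const (1 : ℝ)).indicator (measurable_pi_apply 0 (measurableSet_singleton j)))
    (fun i k hik => hindep.indepFun hik)
    fun i => ⟨(hmeas i).aemeasurable, (hmeas 0).aemeasurable, by rw [hmap i, hmap 0]⟩
  have hmean : ∫ ω, g (ω 0) ∂(Measure.infinitePi fun _ : ℕ => μ) = μ.real {j} := by
    have h := integral_map (μ := Measure.infinitePi fun _ : ℕ => μ) (f := g)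
      (measurable_pi_apply 0).aemeasurable hg.aestronglyMeasurable
    rw [← h, Measure.infinitePi_map_eval]
    exact integral_indicator_one (measurableSet_singleton j)
  filter_upwards [hslln] with ω hω
  rw [hmean] at hω
  refine hω.congr fun n => ?_
  simp only [g, Set.indicator_apply, Set.mem_singleton_iff, Finset.sum_boole]

theorem fIter_eq_iterate_comp_iterate {X : Type*} (f : Fin 2 → X → X)
    (hcomm : f 0 ∘ f 1 = f 1 ∘ f 0) (ω : ℕ → Fin 2) (n : ℕ) :
    fIter f n ω = (f 0)^[((Finset.range n).filter fun m => ω m = 0).card] ∘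
      (f 1)^[((Finset.range n).filter fun m => ω m = 1).card] := by
  have hc : Function.Commute (f 1) (f 0) := fun y => (congrFun hcomm y).symm
  induction n with
  | zero => rfl
  | succ n ih =>
    funext y
    have hω : ω n = 0 ∨ ω n = 1 := by omega
    change f (ω n) (fIter f n ω y) = _
    rw [ih, Finset.range_add_one, Finset.filter_insert, Finset.filter_insert]
    rcases hω with hω | hω
    · simp [hω, ← Function.iterate_succ_apply' (f 0)]
    · simp [hω, (hc.iterate_right _).eq, ← Function.iterate_succ_apply' (f 1)]

/-- Passing to the exponential growth rate in a bound `r ≤ C * exp y`. -/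
theorem inv_mul_elog_le {r C y : ℝ} (hC : 0 < C) (hr : r ≤ C * Real.exp y) {n : ℕ} (hn : 0 < n) :
    (((n : ℝ)⁻¹ : ℝ) : EReal) * elog r ≤ (((Real.log C + y) / n : ℝ) : EReal) := by
  have hn' : (0 : ℝ) < (n : ℝ)⁻¹ := by positivity
  unfold elog
  split_ifs with h
  · simp [EReal.coe_mul_bot_of_pos hn']
  · rw [← EReal.coe_mul, EReal.coe_le_coe_iff, div_eq_inv_mul]
    refine mul_le_mul_of_nonneg_left ?_ hn'.le
    calc Real.log r ≤ Real.log (C * Real.exp y) := Real.log_le_log (not_le.1 h) hr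
      _ = Real.log C + y := by rw [Real.log_mul hC.ne' (Real.exp_pos y).ne', Real.log_exp]

/-- Let `f_1, f_2` be commuting `C¹` maps of a Banach space `X`, `x ∈ X`, `v ≠ 0`, and
`λ_α, λ_2 ∈ ℝ`.  Suppose for every `ε > 0` there is `Q ≥ 1` with
`‖d_x (f_1^{t₁} ∘ f_2^{t₂}) v‖ ≤ Q‖v‖ exp(t₁λ_α + t₂λ₂ + 3(t₁+t₂)ε)` for all
`t₁, t₂ ∈ ℕ`.  Then for `P_ν`-a.e. `ω`,
`limsup_{n→∞} (1/n) log ‖d_x f(n, ω) v‖ ≤ ν₁ λ_α + ν₂ λ₂`. -/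
theorem random_lyapunov_exponent_le_weighted_sum
    {X : Type*} [NormedAddCommGroup X] [NormedSpace ℝ X] [CompleteSpace X]
    (f : Fin 2 → X → X) (hf : ∀ i, ContDiff ℝ 1 (f i))
    (hcomm : f 0 ∘ f 1 = f 1 ∘ f 0)
    (x v : X) (hv : v ≠ 0) (lamα lam₂ : ℝ)
    (hQ : ∀ ε : ℝ, 0 < ε → ∃ Q : ℝ, 1 ≤ Q ∧ ∀ t₁ t₂ : ℕ,
      ‖fderiv ℝ ((f 0)^[t₁] ∘ (f 1)^[t₂]) x v‖ ≤
        Q * ‖v‖ * Real.exp (t₁ * lamα + t₂ * lam₂ + 3 * (t₁ + t₂) * ε))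
    (ν : Fin 2 → ℝ) (hν : ∀ i, 0 < ν i) (hνsum : ν 0 + ν 1 = 1)
    (P : Measure (ℕ → Fin 2)) [IsProbabilityMeasure P]
    (hP : ∀ (n : ℕ) (a : Fin n → Fin 2),
      P {ω | ∀ m : Fin n, ω m = a m} = ENNReal.ofReal (∏ m : Fin n, ν (a m))) :
    ∀ᵐ ω ∂P,
      Filter.limsup
        (fun n : ℕ => (((n : ℝ)⁻¹ : ℝ) : EReal) *
          elog ‖fderiv ℝ (fIter f n ω) x v‖)
        Filter.atTop ≤ ((ν 0 * lamα + ν 1 * lam₂ : ℝ) : EReal) := by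
  have hprob : IsProbabilityMeasure (P.map fun ω : ℕ → Fin 2 => ω 0) :=
    Measure.isProbabilityMeasure_map (measurable_pi_apply 0).aemeasurable
  set μ : Measure (Fin 2) := P.map fun ω : ℕ → Fin 2 => ω 0 with hμ
  have hsingle : ∀ i, μ {i} = ENNReal.ofReal (ν i) := by
    intro i
    rw [hμ, Measure.map_apply (measurable_pi_apply 0) (measurableSet_singleton i)]
    have h := hP 1 fun _ => i
    simp only [Fin.forall_fin_one, Fin.prod_univ_one] at h
    exact h
  have hprod : P = Measure.infinitePi fun _ : ℕ => μ :=
    eq_infinitePi_of_forall_initial_cylinder μ P fun n a => by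
      rw [hP, ENNReal.ofReal_prod_of_nonneg fun m _ => (hν (a m)).le]
      simp only [hsingle]
  have hfreq : ∀ j : Fin 2, ∀ᵐ ω ∂P,
      Tendsto (fun n : ℕ => (((Finset.range n).filter fun m => ω m = j).card : ℝ) / n) atTop
        (𝓝 (ν j)) := by
    intro j
    have h := ae_tendsto_card_filter_div_infinitePi μ j
    rwa [← hprod, measureReal_def, hsingle, ENNReal.toReal_ofReal (hν j).le] at h
  filter_upwards [hfreq 0, hfreq 1] with ω h0 h1
  refine EReal.le_of_forall_lt_iff_le.1 fun z hz => ?_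
  rw [EReal.coe_lt_coe_iff] at hz
  set ε : ℝ := (z - (ν 0 * lamα + ν 1 * lam₂)) / 6 with hε
  obtain ⟨Q, hQ1, hbound⟩ := hQ ε (by rw [hε]; linarith)
  have hC : 0 < Q * ‖v‖ := mul_pos (by linarith) (norm_pos_iff.2 hv)
  have hlim : Tendsto (fun n : ℕ => Real.log (Q * ‖v‖) / n +
      (((Finset.range n).filter fun m => ω m = 0).card : ℝ) / n * (lamα + 3 * ε) +
      (((Finset.range n).filter fun m => ω m = 1).card : ℝ) / n * (lam₂ + 3 * ε)) atTop
      (𝓝 (0 + ν 0 * (lamα + 3 * ε) + ν 1 * (lam₂ + 3 * ε))) :=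
    ((tendsto_const_div_atTop_nhds_zero_nat _).add (h0.mul_const _)).add (h1.mul_const _)
  have hlt : 0 + ν 0 * (lamα + 3 * ε) + ν 1 * (lam₂ + 3 * ε) < z := by
    have hsum : 0 + ν 0 * (lamα + 3 * ε) + ν 1 * (lam₂ + 3 * ε) =
        ν 0 * lamα + ν 1 * lam₂ + 3 * ε := by
      linear_combination 3 * ε * hνsum
    rw [hsum, hε]
    linarith
  refine limsup_le_of_le (h := ?_)
  filter_upwards [hlim.eventually_lt_const hlt, eventually_gt_atTop 0] with n hn hn0
  rw [fIter_eq_iterate_comp_iterate f hcomm]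
  refine (inv_mul_elog_le hC (hbound _ _) hn0).trans (EReal.coe_le_coe_iff.2 (hn.le.trans' ?_))
  exact le_of_eq (by ring)
end

section
/- Let E be a finite-dimensional normed space of dimension m ≥ 1, X a normed space, and T : E → X a bounded linear map. Then for every ε > 0, the image T(B_E) of the closed unit ball B_E of E can be covered by at most (⌊m‖T‖/ε⌋ + 1)^m balls of X of radius at most ε; i.e. r(T(B_E), ε) ≤ (⌊m‖T‖/ε⌋ + 1)^m, where ⌊·⌋ denotes the integer part. -/
/-- `r(A, ε)`: the smallest number `n` (in `ℕ∞`) of balls, of radii each less than `ε`,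
needed to cover `A`; `∞` if no finite cover exists. -/
noncomputable def covNum {Y : Type*} [PseudoMetricSpace Y] (A : Set Y) (ε : ℝ) : ℕ∞ :=
  sInf {n : ℕ∞ | ∃ S : Finset Y, (S.card : ℕ∞) = n ∧ ∃ ρ : Y → ℝ,
    (∀ c ∈ S, ρ c < ε) ∧ A ⊆ ⋃ c ∈ S, Metric.ball c (ρ c)}

/-- A point of `[-1, 1]` is within `1 / k` of the midpoint of one of the `k` intervals of
length `2 / k` into which `[-1, 1]` is divided. -/
theorem exists_fin_abs_sub_midpoint_le {k : ℕ} (hk : 0 < k) {t : ℝ} (ht : |t| ≤ 1) :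
    ∃ j : Fin k, |t - ((2 * (j : ℕ) + 1) / k - 1)| ≤ 1 / k := by
  obtain ⟨h₁, h₂⟩ := abs_le.1 ht
  have hk' : (0 : ℝ) < k := by exact_mod_cast hk
  suffices ∃ j < k, (2 * j : ℝ) ≤ (t + 1) * k ∧ (t + 1) * k ≤ 2 * j + 2 by
    obtain ⟨j, hj, hl, hu⟩ := this
    refine ⟨⟨j, hj⟩, ?_⟩
    have h : t - ((2 * (j : ℝ) + 1) / k - 1) = ((t + 1) * k - (2 * j + 1)) / k := by
      field_simp
      ring
    rw [h, abs_div, abs_of_pos hk']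
    gcongr
    exact abs_le.2 ⟨by linarith, by linarith⟩
  have hs : 0 ≤ (t + 1) * k / 2 := by
    have := mul_nonneg (by linarith : 0 ≤ t + 1) hk'.le
    linarith
  have hfl := Nat.floor_le hs
  have hlt := Nat.lt_floor_add_one ((t + 1) * k / 2)
  by_cases h : ⌊(t + 1) * k / 2⌋₊ < k
  · exact ⟨_, h, by linarith, by linarith⟩
  · have hle : (k : ℝ) ≤ ⌊(t + 1) * k / 2⌋₊ := by exact_mod_cast not_lt.1 h
    refine ⟨k - 1, by lia, ?_, ?_⟩ <;> rw [Nat.cast_pred hk]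
    · linarith
    · nlinarith

/-- The determinant with respect to a basis of a finite-dimensional normed space is continuous. -/
theorem Module.Basis.continuous_det {E ι : Type*} [NormedAddCommGroup E] [NormedSpace ℝ E]
    [FiniteDimensional ℝ E] [Fintype ι] [DecidableEq ι] (b : Module.Basis ι ℝ E) :
    Continuous fun v : ι → E => b.det v := by
  simp only [Module.Basis.det_apply]
  refine Continuous.matrix_det (continuous_matrix fun i j => ?_)
  exact (b.coord i).continuous_of_finiteDimensional.comp (continuous_apply j)

/-- **Auerbach's lemma**: a finite-dimensional real normed space has a basis in the unit ball
whose coordinate functionals are bounded by the norm on the unit ball. -/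
theorem Module.Basis.exists_auerbach {E ι : Type*} [NormedAddCommGroup E] [NormedSpace ℝ E]
    [FiniteDimensional ℝ E] [Fintype ι] [DecidableEq ι] (b : Module.Basis ι ℝ E) :
    ∃ v : Module.Basis ι ℝ E, (∀ i, ‖v i‖ ≤ 1) ∧ ∀ x, ‖x‖ ≤ 1 → ∀ i, |v.repr x i| ≤ 1 := by
  have : ProperSpace E := FiniteDimensional.proper ℝ E
  obtain ⟨v, hv, hmax⟩ := (isCompact_univ_pi fun _ : ι =>
    isCompact_closedBall (0 : E) 1).exists_isMaxOn ⟨0, by simp⟩ b.continuous_det.abs.continuousOn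
  have hv1 : ∀ i, ‖v i‖ ≤ 1 := by simpa using hv
  have hpos : 0 < |b.det v| := by
    have hmem : (fun i => ‖b i‖⁻¹ • b i) ∈
        Set.univ.pi fun _ : ι => Metric.closedBall (0 : E) 1 := by
      intro i _
      simp [_root_.norm_smul, b.ne_zero i]
    refine lt_of_lt_of_le ?_ (hmax hmem)
    change 0 < |b.det fun i => ‖b i‖⁻¹ • b i|
    rw [AlternatingMap.map_smul_univ, b.det_self, smul_eq_mul, mul_one, abs_pos]
    exact Finset.prod_ne_zero_iff.2 fun i _ => inv_ne_zero (norm_ne_zero_iff.2 (b.ne_zero i))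
  obtain ⟨hli, hsp⟩ := b.is_basis_iff_det.2 (isUnit_iff_ne_zero.2 (abs_pos.1 hpos))
  refine ⟨Module.Basis.mk hli hsp.ge, by simpa using hv1, fun x hx i => ?_⟩
  have hdet := LinearMap.congr_fun (b.det_smul_mk_coord_eq_det_update hli hsp.ge i) x
  have hmem : Function.update v i x ∈ Set.univ.pi fun _ : ι => Metric.closedBall (0 : E) 1 := by
    intro j _
    rcases eq_or_ne j i with rfl | hj
    · simpa using hx
    · simpa [hj] using hv1 j
  have hle : |b.det (Function.update v i x)| ≤ |b.det v| := hmax hmem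
  have hmul : b.det v * (Module.Basis.mk hli hsp.ge).repr x i =
      b.det (Function.update v i x) := hdet
  rw [← hmul, abs_mul] at hle
  exact le_of_mul_le_mul_left (by simpa using hle) hpos

/-- A set covered by the `ρ`-balls around a finite family of points, with `ρ < ε`, has covering
number at most the size of the family. -/
theorem covNum_le_card {Y κ : Type*} [PseudoMetricSpace Y] [Fintype κ] {A : Set Y} {ε ρ : ℝ}
    (c : κ → Y) (hρ : ρ < ε) (h : ∀ y ∈ A, ∃ g, dist y (c g) < ρ) :
    covNum A ε ≤ (Fintype.card κ : ℕ∞) := by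
  classical
  calc covNum A ε ≤ ((Finset.univ.image c).card : ℕ∞) := by
        refine sInf_le ⟨_, rfl, fun _ => ρ, fun _ _ => hρ, fun y hy => ?_⟩
        simpa using h y hy
    _ ≤ (Fintype.card κ : ℕ∞) := by exact_mod_cast Finset.card_image_le

/-- Let `E` be a finite-dimensional normed space with `dim E = m ≥ 1`, `X` a normed
space and `T : E → X` a bounded linear map.  For every `ε > 0`, the image `T(B_E)` of
the closed unit ball of `E` can be covered by at most `(⌊m‖T‖/ε⌋ + 1)^m` balls of
radius at most `ε`: `r(T(B_E), ε) ≤ (⌊m‖T‖/ε⌋ + 1)^m`. -/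
theorem covNum_image_closedBall_le
    {E X : Type*} [NormedAddCommGroup E] [NormedSpace ℝ E] [FiniteDimensional ℝ E]
    [NormedAddCommGroup X] [NormedSpace ℝ X]
    {m : ℕ} (hm : 1 ≤ m) (hdim : Module.finrank ℝ E = m)
    (T : E →L[ℝ] X) {ε : ℝ} (hε : 0 < ε) :
    covNum (⇑T '' Metric.closedBall (0 : E) 1) ε ≤
      (((⌊(m : ℝ) * ‖T‖ / ε⌋₊ + 1) ^ m : ℕ) : ℕ∞) := by
  obtain ⟨v, hv, hcoord⟩ := (Module.finBasisOfFinrankEq ℝ E hdim).exists_auerbach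
  generalize hk : ⌊(m : ℝ) * ‖T‖ / ε⌋₊ + 1 = k
  have hkpos : 0 < k := hk ▸ Nat.succ_pos _
  have hk0 : (0 : ℝ) < k := by exact_mod_cast hkpos
  have hlt : (m : ℝ) * ‖T‖ / k < ε := by
    have h : (m : ℝ) * ‖T‖ / ε < k := by
      rw [← hk]
      push_cast
      exact Nat.lt_floor_add_one _
    rw [div_lt_iff₀ hε] at h
    rwa [div_lt_iff₀ hk0, mul_comm ε]
  obtain ⟨ρ, hρ, hρε⟩ := exists_between hlt
  have hcard : Fintype.card (Fin m → Fin k) = k ^ m := by simp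
  rw [← hcard]
  refine covNum_le_card (fun g : Fin m → Fin k =>
    T (∑ i, ((2 * (g i : ℕ) + 1) / k - 1 : ℝ) • v i)) hρε ?_
  rintro _ ⟨x, hx, rfl⟩
  choose g hg using fun i =>
    exists_fin_abs_sub_midpoint_le hkpos (hcoord x (by simpa using hx) i)
  refine ⟨g, lt_of_le_of_lt ?_ hρ⟩
  rw [dist_eq_norm, ← map_sub]
  nth_rewrite 1 [← v.sum_repr x]
  rw [← Finset.sum_sub_distrib]
  have hsum : ‖∑ i, (v.repr x i • v i - ((2 * (g i : ℕ) + 1) / k - 1 : ℝ) • v i)‖ ≤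
      m * (1 / k) := by
    refine (norm_sum_le_of_le _ fun i _ => ?_).trans_eq (b := ∑ _i : Fin m, (1 / k : ℝ)) (by simp)
    rw [← sub_smul, norm_smul, Real.norm_eq_abs]
    exact (mul_le_of_le_one_right (abs_nonneg _) (hv i)).trans (hg i)
  calc _ ≤ ‖T‖ * (m * (1 / k)) := T.le_opNorm_of_le hsum
    _ = m * ‖T‖ / k := by ring
end

section
/- Let X be a normed space, E ⊆ X a linear subspace of finite dimension m ≥ 1, and T : X → X a bounded linear map whose restriction T|_E is injective with bounded inverse (T|_E)^{−1} : T(E) → E. Then for every δ > 0, the image T(B_E) of the unit ball B_E of E contains a δ-separated set (any two distinct points at distance at least δ) of cardinality at least max{ (2 δ^{−1} m^{−1} ‖(T|_E)^{−1}‖^{−1})^m , 1 }; i.e. S(T(B_E), δ) ≥ max{ (2/(δ m ‖(T|_E)^{−1}‖))^m , 1 }. -/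
theorem Metric.packingNumber_ne_top_of_totallyBounded {Y : Type*} [PseudoEMetricSpace Y]
    {A : Set Y} (hA : TotallyBounded A) {ε : NNReal} (hε : ε ≠ 0) :
    Metric.packingNumber ε A ≠ ⊤ := by
  obtain ⟨N, -, hN, hcov⟩ := Metric.exists_finite_isCover_of_totallyBounded
    (ε := ε / 2) (by positivity) hA
  have h := Metric.packingNumber_two_mul_le_externalCoveringNumber (ε / 2) A
  rw [mul_div_cancel₀ ε two_ne_zero] at h
  exact ((h.trans hcov.externalCoveringNumber_le_encard).trans_lt hN.encard_lt_top).ne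

/-- Volume lower bound for packings of the unit ball of a finite-dimensional normed space. -/
theorem exists_separated_unitBall_inv_pow_le_card {F : Type*} [NormedAddCommGroup F]
    [NormedSpace ℝ F] [FiniteDimensional ℝ F] {r : ℝ} (hr : 0 < r) :
    ∃ S : Finset F, (∀ x ∈ S, ‖x‖ ≤ 1) ∧ (∀ x ∈ S, ∀ y ∈ S, x ≠ y → r ≤ dist x y) ∧
      r⁻¹ ^ Module.finrank ℝ F ≤ (S.card : ℝ) := by
  have : ProperSpace F := FiniteDimensional.proper ℝ F
  lift r to NNReal using hr.le
  have htop : Metric.packingNumber r (Metric.closedBall (0 : F) 1) ≠ ⊤ :=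
    Metric.packingNumber_ne_top_of_totallyBounded
      (isCompact_closedBall (0 : F) 1).totallyBounded (by exact_mod_cast hr.ne')
  have hfin : (Metric.maximalSeparatedSet r (Metric.closedBall (0 : F) 1)).Finite := by
    rw [← Set.encard_ne_top_iff, Metric.encard_maximalSeparatedSet htop]
    exact htop
  refine ⟨hfin.toFinset, fun x hx => ?_, fun x hx y hy hxy => ?_, ?_⟩
  · simpa using Metric.maximalSeparatedSet_subset (hfin.mem_toFinset.1 hx)
  · have h : (r : ENNReal) < edist x y := Metric.isSeparated_maximalSeparatedSet (hfin.mem_toFinset.1 hx)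
      (hfin.mem_toFinset.1 hy) hxy
    rw [edist_nndist, ENNReal.coe_lt_coe] at h
    exact_mod_cast h.le
  · have hcov := Metric.isCover_iff_subset_iUnion_closedBall.1
      (Metric.isCover_maximalSeparatedSet htop)
    borelize F
    let μ : MeasureTheory.Measure F := MeasureTheory.Measure.addHaar
    have hpos : 0 < μ.real (Metric.closedBall (0 : F) 1) :=
      ENNReal.toReal_pos (Metric.measure_closedBall_pos μ _ one_pos).ne'
        MeasureTheory.measure_closedBall_lt_top.ne
    have hle : μ.real (Metric.closedBall (0 : F) 1) ≤
        ∑ y ∈ hfin.toFinset, μ.real (Metric.closedBall y r) := by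
      refine (MeasureTheory.measureReal_mono ?_ ?_).trans
        (MeasureTheory.measureReal_biUnion_finset_le _ _)
      · simpa using hcov
      · exact ((MeasureTheory.measure_biUnion_finset_le _ _).trans_lt
          (ENNReal.sum_lt_top.2 fun _ _ => MeasureTheory.measure_closedBall_lt_top)).ne
    simp_rw [MeasureTheory.Measure.addHaar_real_closedBall' μ _ hr.le] at hle
    rw [Finset.sum_const, nsmul_eq_mul, ← mul_assoc] at hle
    have h1 := (le_mul_iff_one_le_left hpos).1 hle
    rw [inv_pow]
    exact (inv_le_iff_one_le_mul₀ (pow_pos hr _)).2 h1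

/-- Equally spaced points on a diameter of the unit ball. -/
theorem exists_separated_unitBall_two_div_le_card {F : Type*} [NormedAddCommGroup F]
    [NormedSpace ℝ F] [Nontrivial F] {r : ℝ} (hr : 0 < r) :
    ∃ S : Finset F, (∀ x ∈ S, ‖x‖ ≤ 1) ∧ (∀ x ∈ S, ∀ y ∈ S, x ≠ y → r ≤ dist x y) ∧
      2 / r ≤ (S.card : ℝ) := by
  classical
  obtain ⟨u, hu⟩ := exists_norm_eq F zero_le_one
  let f : ℕ → F := fun k => (k * r - 1) • u
  have hdist (j k : ℕ) : dist (f j) (f k) = |(j : ℝ) - k| * r := by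
    rw [dist_eq_norm, ← sub_smul, norm_smul, hu, mul_one, Real.norm_eq_abs,
      sub_sub_sub_cancel_right, ← sub_mul, abs_mul, abs_of_pos hr]
  have hsep {j k : ℕ} (hjk : j ≠ k) : r ≤ dist (f j) (f k) := by
    rw [hdist]
    refine le_mul_of_one_le_left hr.le ?_
    have : (1 : ℤ) ≤ |(j : ℤ) - k| := Int.one_le_abs (by omega)
    exact_mod_cast this
  have hinj : Function.Injective f := fun j k h => by
    by_contra hjk
    have := hsep hjk
    rw [h, dist_self] at this
    linarith
  refine ⟨(Finset.range (⌊2 / r⌋₊ + 1)).image f, ?_, ?_, ?_⟩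
  · simp only [Finset.mem_image, Finset.mem_range, forall_exists_index, and_imp]
    rintro _ k hk rfl
    have hk' : (k : ℝ) ≤ 2 / r :=
      (Nat.le_floor_iff (by positivity)).1 (Nat.lt_succ_iff.1 hk)
    rw [le_div_iff₀ hr] at hk'
    have : 0 ≤ k * r := by positivity
    rw [norm_smul, hu, mul_one, Real.norm_eq_abs, abs_le]
    constructor <;> linarith
  · simp only [Finset.mem_image, forall_exists_index, and_imp]
    rintro _ j - rfl _ k - rfl hne
    exact hsep (ne_of_apply_ne f hne)
  · rw [Finset.card_image_of_injective _ hinj, Finset.card_range]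
    exact_mod_cast (Nat.lt_floor_add_one (2 / r)).le

theorem exists_separated_unitBall_le_card {F : Type*} [NormedAddCommGroup F]
    [NormedSpace ℝ F] {m : ℕ} (hm : 1 ≤ m) (hdim : Module.finrank ℝ F = m)
    {r : ℝ} (hr : 0 < r) :
    ∃ S : Finset F, (∀ x ∈ S, ‖x‖ ≤ 1) ∧ (∀ x ∈ S, ∀ y ∈ S, x ≠ y → r ≤ dist x y) ∧
      (2 / (m * r)) ^ m ≤ (S.card : ℝ) := by
  obtain rfl | hm2 := hm.eq_or_lt
  · have : Nontrivial F := Module.nontrivial_of_finrank_pos (R := ℝ) (by omega)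
    simpa using exists_separated_unitBall_two_div_le_card (F := F) hr
  · have : FiniteDimensional ℝ F := Module.finite_of_finrank_pos (by omega)
    obtain ⟨S, hS, hsep, hcard⟩ := exists_separated_unitBall_inv_pow_le_card (F := F) hr
    refine ⟨S, hS, hsep, le_trans ?_ hcard⟩
    rw [hdim, ← div_div, div_eq_mul_inv _ r]
    gcongr
    refine mul_le_of_le_one_left (by positivity) ?_
    rw [div_le_one (by positivity)]
    exact_mod_cast hm2

/-- Let `X` be a normed space, `E ⊆ X` a subspace of finite dimension `m ≥ 1`, and
`T : X → X` a bounded linear map whose restriction to `E` is injective with bounded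
inverse of norm at most `C` (i.e. `‖v‖ ≤ C‖Tv‖` for all `v ∈ E`).  Then for every
`δ > 0` the image `T(B_E)` of the unit ball of `E` contains a `δ`-separated set of
cardinality at least `max{(2/(δ m C))^m, 1}`. -/
theorem exists_separated_set_in_image_unitBall
    {X : Type*} [NormedAddCommGroup X] [NormedSpace ℝ X]
    (T : X →L[ℝ] X) (E : Submodule ℝ X)
    {m : ℕ} (hm : 1 ≤ m) (hdim : Module.finrank ℝ E = m)
    {C : ℝ} (hC : 0 < C) (hCinv : ∀ v ∈ E, ‖v‖ ≤ C * ‖T v‖)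
    {δ : ℝ} (hδ : 0 < δ) :
    ∃ S : Finset X,
      (S : Set X) ⊆ ⇑T '' ((E : Set X) ∩ Metric.closedBall (0 : X) 1) ∧
      (∀ x ∈ S, ∀ y ∈ S, x ≠ y → δ ≤ dist x y) ∧
      max ((2 / (δ * m * C)) ^ m) 1 ≤ (S.card : ℝ) := by
  classical
  have hm0 : (0 : ℝ) < m := by exact_mod_cast hm
  obtain ⟨S, hS, hsep, hcard⟩ :=
    exists_separated_unitBall_le_card hm hdim (r := δ * C) (by positivity)
  have hdist {v w : E} (hv : v ∈ S) (hw : w ∈ S) (hvw : v ≠ w) :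
      δ ≤ dist (T v) (T w) := by
    have h1 := hsep v hv w hw hvw
    have h2 := hCinv _ (v - w).2
    rw [dist_eq_norm] at h1 ⊢
    rw [← map_sub]
    refine le_of_mul_le_mul_left ?_ hC
    rw [mul_comm C δ]
    exact h1.trans h2
  have hinj : Set.InjOn (fun v : E => T v) S := fun v hv w hw h => by
    by_contra hvw
    have := hdist hv hw hvw
    rw [show T v = T w from h, dist_self] at this
    linarith
  refine ⟨S.image fun v : E => T v, ?_, ?_, ?_⟩
  · intro x hx
    obtain ⟨v, hv, rfl⟩ := Finset.mem_image.1 (Finset.mem_coe.1 hx)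
    exact ⟨v, ⟨v.2, by simpa using hS v hv⟩, rfl⟩
  · simp only [Finset.mem_image, forall_exists_index, and_imp]
    rintro _ v hv rfl _ w hw rfl hne
    exact hdist hv hw fun h => hne (by rw [h])
  · rw [Finset.card_image_of_injOn hinj,
      show δ * m * C = m * (δ * C) by ring]
    have hpos : (0 : ℝ) < S.card := lt_of_lt_of_le (by positivity) hcard
    exact max_le hcard (by exact_mod_cast hpos)
end

section
/- Let X be a Banach space with metric d, f_1, f_2 : X → X continuous maps, and K ⊆ X a nonempty compact set with f_1(K) = K and f_2(K) = K. Let K_f = { (x_n)_{n∈ℕ} ∈ K^ℕ : for every n ∈ ℕ, x_{n+1} = f_{i_n}(x_n) for some i_n ∈ {1,2} } with the metric d̄((x_n),(y_n)) = Σ_{n=0}^∞ d(x_n, y_n)/2^n, and let σ_f : K_f → K_f be the shift σ_f((x_n)_n) = (x_{n+1})_n. Let Ω = {1,2}^ℕ with the product topology, F : Ω × K → Ω × K the skew product F(ω, x) = (θω, f_{ω_0}(x)), and define π̃ : Ω × K → K^ℕ by π̃(ω, x) = (f(n, ω)(x))_{n∈ℕ}. Then π̃ takes values in K_f, π̃ is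 continuous, π̃ is surjective onto K_f, and π̃ ∘ F = σ_f ∘ π̃. -/
/-- The left shift `θ` on sequences: `(θω)_n = ω_{n+1}`. -/
def shiftSeq {α : Type*} (ω : ℕ → α) : ℕ → α := fun n => ω (n + 1)

/-- The orbit space `K_f` of the `ℕ²`-action generated by `f 0, f 1` on `K`:
sequences in `K` in which each term is mapped to the next by one of the generators. -/
def orbitSpace {X : Type*} (f : Fin 2 → X → X) (K : Set X) : Set (ℕ → X) :=
  {x : ℕ → X | (∀ n, x n ∈ K) ∧ ∀ n : ℕ, ∃ i : Fin 2, x (n + 1) = f i (x n)}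

/-- The map `π̃ : Ω × K → K^ℕ`, `π̃(ω, x) = (f(n, ω) x)_{n ∈ ℕ}`. -/
def piTilde {X : Type*} (f : Fin 2 → X → X) : ((ℕ → Fin 2) × X) → (ℕ → X) :=
  fun p n => fIter f n p.1 p.2

theorem fIter_mem {X : Type*} {f : Fin 2 → X → X} {K : Set X}
    (hK : ∀ i, Set.MapsTo (f i) K K) (ω : ℕ → Fin 2) {x : X} (hx : x ∈ K) (n : ℕ) :
    fIter f n ω x ∈ K := by
  induction n with
  | zero => exact hx
  | succ n ih => exact hK _ ih

theorem continuous_fIter {X : Type*} [TopologicalSpace X] {f : Fin 2 → X → X}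
    (hf : ∀ i, Continuous (f i)) (n : ℕ) :
    Continuous fun p : (ℕ → Fin 2) × X => fIter f n p.1 p.2 := by
  induction n with
  | zero => exact continuous_snd
  | succ n ih =>
    have huncurry : Continuous fun q : Fin 2 × X => f q.1 q.2 :=
      continuous_prod_of_discrete_left.mpr hf
    exact huncurry.comp (((continuous_apply n).comp continuous_fst).prodMk ih)

theorem fIter_shiftSeq {X : Type*} (f : Fin 2 → X → X) (ω : ℕ → Fin 2) (x : X) (n : ℕ) :
    fIter f n (shiftSeq ω) (f (ω 0) x) = fIter f (n + 1) ω x := by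
  induction n with
  | zero => rfl
  | succ n ih => exact congrArg (f (ω (n + 1))) ih

theorem fIter_eq_of_forall_succ {X : Type*} {f : Fin 2 → X → X} {ω : ℕ → Fin 2} {y : ℕ → X}
    (hy : ∀ n, y (n + 1) = f (ω n) (y n)) (n : ℕ) : fIter f n ω (y 0) = y n := by
  induction n with
  | zero => rfl
  | succ n ih => rw [hy, ← ih, fIter]

/-- Let `f_1, f_2 : X → X` be continuous maps of a Banach space `X` and `K` a nonempty
compact set with `f_1(K) = K`, `f_2(K) = K`.  Then `π̃(ω, x) = (f(n, ω) x)_n` maps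
`Ω × K` into the orbit space `K_f`, is continuous, is surjective onto `K_f`, and
intertwines the skew product `F(ω, x) = (θω, f_{ω_0} x)` with the shift `σ_f`. -/
theorem piTilde_into_orbitSpace_continuous_surjective_semiconj
    {X : Type*} [NormedAddCommGroup X]
    (f : Fin 2 → X → X) (hf : ∀ i, Continuous (f i))
    (K : Set X) (hK : IsCompact K) (hKne : K.Nonempty) (hinv : ∀ i, f i '' K = K) :
    (∀ (ω : ℕ → Fin 2), ∀ x ∈ K, piTilde f (ω, x) ∈ orbitSpace f K) ∧
    Continuous (piTilde f) ∧
    (∀ y ∈ orbitSpace f K, ∃ ω : ℕ → Fin 2, ∃ x ∈ K, piTilde f (ω, x) = y) ∧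
    (∀ (ω : ℕ → Fin 2) (x : X),
      piTilde f (shiftSeq ω, f (ω 0) x) = fun n => piTilde f (ω, x) (n + 1)) := by
  have hmaps : ∀ i, Set.MapsTo (f i) K K := fun i => Set.mapsTo_iff_image_subset.mpr (hinv i).subset
  refine ⟨fun ω x hx => ⟨fIter_mem hmaps ω hx, fun n => ⟨ω n, rfl⟩⟩,
    continuous_pi (continuous_fIter hf), ?_, fun ω x => funext (fIter_shiftSeq f ω x)⟩
  rintro y ⟨hyK, hy⟩
  choose ω hω using hy
  exact ⟨ω, y 0, hyK 0, funext (fIter_eq_of_forall_succ hω)⟩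
end
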